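/- Let φ : A(𝕋) × A(𝕋) → ℂ be a bounded bilinear map with ‖φ‖ ≤ 1, and let 0 ≤ α ≤ 1 be such that |φ(f,g)| ≤ α‖f‖_{A(𝕋)}‖g‖_{A(𝕋)} whenever f, g ∈ A(𝕋) satisfy supp f ∩ supp g = ∅. Then for every n ∈ ℤ and all f, h ∈ A(𝕋), |φ(f·e_n, h) − φ(f, e_n·h)| ≤ 12·√(π(1+√2))·√α·‖f‖_{A(𝕋)}‖h‖_{A(𝕋)}, where e_n ∈ A(𝕋) is given by e_n(s) = e^{ins}. -/

import Mathlib

open MeasureTheory AddCircle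

noncomputable section

local instance : Fact (0 < 2 * Real.pi) := ⟨by positivity⟩

/-- The circle `𝕋 = ℝ/2πℤ`. -/
abbrev Circle2Pi : Type := AddCircle (2 * Real.pi)

/-- Membership in the Fourier algebra `A(𝕋)`: continuity together with absolute
summability of the Fourier coefficients. -/
def MemFourierAlg (f : Circle2Pi → ℂ) : Prop :=
  Continuous f ∧ Summable fun n : ℤ => ‖fourierCoeff f n‖

/-- The norm of the Fourier algebra `A(𝕋)`: `‖f‖ = ∑ₙ |f̂(n)|`. -/
def fourierAlgNorm (f : Circle2Pi → ℂ) : ℝ :=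
  ∑' n : ℤ, ‖fourierCoeff f n‖

/-- Normalized convolution on `𝕋` (with respect to the probability Haar measure). -/
def circleConv (f g : Circle2Pi → ℂ) : Circle2Pi → ℂ :=
  fun x => ∫ y : Circle2Pi, f y * g (x - y) ∂haarAddCircle


lemma norm_fourier_pt (k : ℤ) (s : Circle2Pi) : ‖fourier k s‖ = 1 := by
  rw [fourier_apply, Circle.norm_coe]

lemma coeff_series {ι : Type*} [Countable ι] (c : ι → ℂ) (hc : Summable fun i => ‖c i‖)
    (σ : ι → ℤ) (k : ℤ) :
    fourierCoeff (fun s : Circle2Pi => ∑' i, c i * fourier (σ i) s) k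
      = ∑' i, if σ i = k then c i else 0 := by
  have h1 : ∀ i, ∫ t : Circle2Pi, fourier (-k) t * (c i * fourier (σ i) t) ∂haarAddCircle
      = if σ i = k then c i else 0 := by
    intro i
    have h := congrFun (fourierCoeff_fourier (T := 2 * Real.pi) (σ i)) k
    rw [fourierCoeff] at h
    have : ∀ t : Circle2Pi, fourier (-k) t * (c i * fourier (σ i) t)
      = c i * (fourier (-k) t • fourier (σ i) t) := by
      intro t; rw [smul_eq_mul]; ring
    simp_rw [this]
    rw [integral_const_mul, h, Pi.single_apply]
    by_cases hk : σ i = k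
    · simp [hk]
    · simp [hk, Ne.symm hk]
  rw [fourierCoeff]
  simp_rw [smul_eq_mul, ← h1, ← tsum_mul_left]
  symm
  apply integral_tsum_of_summable_integral_norm
  · intro i
    refine Continuous.integrable_of_hasCompactSupport ?_ ?_
    · exact (map_continuous (fourier (-k))).mul (continuous_const.mul (map_continuous (fourier (σ i))))
    · exact HasCompactSupport.of_compactSpace _
  · simpa [norm_mul, norm_fourier_pt, -fourier_apply] using hc

lemma mem_series {ι : Type*} [Countable ι] (c : ι → ℂ) (hc : Summable fun i => ‖c i‖)
    (σ : ι → ℤ) :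
    MemFourierAlg (fun s : Circle2Pi => ∑' i, c i * fourier (σ i) s) ∧
    fourierAlgNorm (fun s : Circle2Pi => ∑' i, c i * fourier (σ i) s) ≤ ∑' i, ‖c i‖ := by
  set G : ι × ℤ → ℝ := fun p => if σ p.1 = p.2 then ‖c p.1‖ else 0 with hG
  have hG0 : 0 ≤ G := fun p => by simp only [hG]; split_ifs <;> simp
  have h1 : ∀ i, HasSum (fun k => G (i, k)) ‖c i‖ := by
    intro i
    have := hasSum_ite_eq (σ i) ‖c i‖
    simpa [hG, eq_comm] using this
  have hGs : Summable G := by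
    rw [summable_prod_of_nonneg hG0]
    refine ⟨fun i => (h1 i).summable, ?_⟩
    simpa [fun i => (h1 i).tsum_eq] using hc
  have hb : ∀ k, ‖fourierCoeff (fun s : Circle2Pi => ∑' i, c i * fourier (σ i) s) k‖
      ≤ ∑' i, G (i, k) := by
    intro k
    rw [coeff_series c hc]
    have e : ∀ i, G (i, k) = ‖if σ i = k then c i else 0‖ := by
      intro i; simp only [hG]; split_ifs <;> simp
    simp_rw [e]
    apply norm_tsum_le_tsum_norm
    simp_rw [← e]
    exact hGs.prod_symm.prod_factor k
  have hs2 : Summable fun k => ∑' i, G (i, k) := hGs.prod_symm.prod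
  have hs : Summable fun k => ‖fourierCoeff (fun s : Circle2Pi => ∑' i, c i * fourier (σ i) s) k‖ :=
    Summable.of_nonneg_of_le (fun _ => norm_nonneg _) hb hs2
  refine ⟨⟨?_, hs⟩, ?_⟩
  · refine continuous_tsum (u := fun i => ‖c i‖) ?_ hc ?_
    · intro i
      exact continuous_const.mul (map_continuous (fourier (σ i)))
    · intro i s
      rw [norm_mul, norm_fourier_pt, mul_one]
  · refine (hs.tsum_le_tsum hb hs2).trans ?_
    rw [Summable.tsum_comm' (f := fun i k => G (i, k)) hGs
      (fun i => (h1 i).summable) (fun k => hGs.prod_symm.prod_factor k)]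
    simp [fun i => (h1 i).tsum_eq]

lemma mem_expand {f : Circle2Pi → ℂ} (hf : MemFourierAlg f) (s : Circle2Pi) :
    f s = ∑' k : ℤ, fourierCoeff f k * fourier k s := by
  have := has_pointwise_sum_fourier_series_of_summable (f := ⟨f, hf.1⟩) hf.2.of_norm s
  exact this.tsum_eq.symm

lemma memA_fourier (k : ℤ) : MemFourierAlg (fun s => fourier k s) ∧
    fourierAlgNorm (fun s => fourier k s) ≤ 1 := by
  have := mem_series (ι := Unit) (fun _ => 1) (by exact (hasSum_fintype _).summable) (fun _ => k)
  simpa [-fourier_apply] using this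

lemma series_hasSum {ι : Type*} [Countable ι] (L : (Circle2Pi → ℂ) →ₗ[ℂ] ℂ) (M : ℝ)
    (hL : ∀ f, MemFourierAlg f → ‖L f‖ ≤ M * fourierAlgNorm f) (hM : 0 ≤ M)
    (c : ι → ℂ) (hc : Summable fun i => ‖c i‖) (σ : ι → ℤ) :
    HasSum (fun i => c i * L (fun s => fourier (σ i) s))
      (L (fun s => ∑' i, c i * fourier (σ i) s)) := by
  classical
  rw [HasSum, SummationFilter.unconditional_filter]
  rw [tendsto_iff_norm_sub_tendsto_zero]
  have hlim : Filter.Tendsto (fun t : Finset ι => M * (∑' i, ‖c i‖ - ∑ i ∈ t, ‖c i‖))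
      Filter.atTop (nhds 0) := by
    have : Filter.Tendsto (fun t : Finset ι => ∑ i ∈ t, ‖c i‖) Filter.atTop
      (nhds (∑' i, ‖c i‖)) := hc.hasSum
    simpa using ((tendsto_const_nhds (x := ∑' i, ‖c i‖)).sub this).const_mul M
  refine squeeze_zero (fun _ => norm_nonneg _) (fun t => ?_) hlim
  set d : ι → ℂ := fun i => if i ∈ t then 0 else c i with hd
  have hdn : ∀ i, ‖d i‖ = ‖c i‖ - if i ∈ t then ‖c i‖ else 0 := by
    intro i; simp only [hd]; split_ifs <;> simp
  have hfin : HasSum (fun i => if i ∈ t then ‖c i‖ else 0) (∑ i ∈ t, ‖c i‖) := by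
    have := hasSum_sum_of_ne_finset_zero (f := fun i => if i ∈ t then ‖c i‖ else 0) (s := t)
      (L := .unconditional ι) (by intro b hb; simp [hb])
    simpa [Finset.sum_ite_mem] using this
  have hds : HasSum (fun i => ‖d i‖) (∑' i, ‖c i‖ - ∑ i ∈ t, ‖c i‖) := by
    simp_rw [hdn]
    exact hc.hasSum.sub hfin
  have hmem := mem_series d hds.summable σ
  rw [hds.tsum_eq] at hmem
  have key : L (fun s => ∑' i, d i * fourier (σ i) s) =
      L (fun s => ∑' i, c i * fourier (σ i) s) - ∑ i ∈ t, c i * L (fun s => fourier (σ i) s) := by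
    have : (fun s : Circle2Pi => ∑' i, d i * fourier (σ i) s) =
        (fun s => ∑' i, c i * fourier (σ i) s) - ∑ i ∈ t, c i • (fun s => fourier (σ i) s) := by
      funext s
      simp only [Pi.sub_apply, Finset.sum_apply, Pi.smul_apply, smul_eq_mul]
      have h1 : HasSum (fun i => c i * fourier (σ i) s) (∑' i, c i * fourier (σ i) s) := by
        apply Summable.hasSum
        apply Summable.of_norm
        simpa [norm_mul, norm_fourier_pt, -fourier_apply] using hc
      have h2 : HasSum (fun i => if i ∈ t then c i * fourier (σ i) s else 0)
          (∑ i ∈ t, c i * fourier (σ i) s) := by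
        have := hasSum_sum_of_ne_finset_zero
          (f := fun i => if i ∈ t then c i * fourier (σ i) s else 0) (s := t)
          (L := .unconditional ι) (by intro b hb; simp [hb])
        simpa [Finset.sum_ite_mem, -fourier_apply] using this
      rw [← (h1.sub h2).tsum_eq]
      congr 1; funext i
      simp only [hd]; split_ifs <;> simp
    rw [this, map_sub, map_sum]
    simp only [map_smul, smul_eq_mul]
  rw [norm_sub_rev, ← key]
  exact (hL _ hmem.1).trans (mul_le_mul_of_nonneg_left hmem.2 hM)

lemma algNorm_nonneg (f : Circle2Pi → ℂ) : 0 ≤ fourierAlgNorm f :=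
  tsum_nonneg fun _ => norm_nonneg _

lemma series_hasSum2 {ι κ : Type*} [Countable ι] [Countable κ]
    (φ : (Circle2Pi → ℂ) →ₗ[ℂ] (Circle2Pi → ℂ) →ₗ[ℂ] ℂ)
    (hφnorm : ∀ f g : Circle2Pi → ℂ, MemFourierAlg f → MemFourierAlg g →
      ‖φ f g‖ ≤ fourierAlgNorm f * fourierAlgNorm g)
    (c : ι → ℂ) (hc : Summable fun i => ‖c i‖) (σ : ι → ℤ)
    (d : κ → ℂ) (hd : Summable fun i => ‖d i‖) (τ : κ → ℤ) :
    HasSum (fun p : ι × κ => c p.1 * d p.2 *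
        φ (fun s => fourier (σ p.1) s) (fun s => fourier (τ p.2) s))
      (φ (fun s => ∑' i, c i * fourier (σ i) s) (fun s => ∑' i, d i * fourier (τ i) s)) := by
  have hb : ∀ a b : ℤ, ‖φ (fun s => fourier a s) (fun s => fourier b s)‖ ≤ 1 := by
    intro a b
    refine (hφnorm _ _ (memA_fourier a).1 (memA_fourier b).1).trans ?_
    exact mul_le_one₀ (memA_fourier a).2 (algNorm_nonneg _) (memA_fourier b).2
  have hs : Summable (fun p : ι × κ => c p.1 * d p.2 *
        φ (fun s => fourier (σ p.1) s) (fun s => fourier (τ p.2) s)) := by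
    apply Summable.of_norm_bounded (hc.mul_of_nonneg hd (fun _ => norm_nonneg _) (fun _ => norm_nonneg _))
    intro p
    rw [norm_mul, norm_mul]
    exact mul_le_of_le_one_right (by positivity) (hb _ _)
  have hD := mem_series d hd τ
  have h1 := series_hasSum (φ.flip (fun s => ∑' i, d i * fourier (τ i) s))
    (fourierAlgNorm (fun s => ∑' i, d i * fourier (τ i) s))
    (fun f hf => (hφnorm f _ hf hD.1).trans (mul_comm _ _).le) (algNorm_nonneg _) c hc σ
  have h2 : ∀ i, HasSum (fun j => c i * d j *
        φ (fun s => fourier (σ i) s) (fun s => fourier (τ j) s))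
        (c i * φ (fun s => fourier (σ i) s) (fun s => ∑' i, d i * fourier (τ i) s)) := by
    intro i
    have := series_hasSum (φ (fun s => fourier (σ i) s)) (fourierAlgNorm (fun s => fourier (σ i) s))
      (fun f hf => hφnorm _ f (memA_fourier _).1 hf) (algNorm_nonneg _) d hd τ
    simpa [mul_assoc, -fourier_apply] using this.mul_left (c i)
  have h3 := hs.hasSum.prod_fiberwise h2
  have := h3.unique h1
  rw [LinearMap.flip_apply] at this
  rw [← this]
  exact hs.hasSum

lemma fourier_affine (i n : ℤ) (s x : Circle2Pi) :
    fourier i (n • s + x) = fourier (n * i) s * fourier i x := by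
  simp only [fourier_apply, smul_add, toCircle_add, Circle.coe_mul, smul_smul]
  rw [mul_comm i n]

lemma affine_eq {F : Circle2Pi → ℂ} (hF : MemFourierAlg F) (a n : ℤ) (x s : Circle2Pi) :
    fourier a s * F (n • s + x) =
      ∑' i : ℤ, (fourierCoeff F i * fourier i x) * fourier (a + n * i) s := by
  rw [mem_expand hF, ← tsum_mul_left]
  congr 1; funext i
  rw [fourier_affine, fourier_add]; ring

lemma affine_tsupport (F : Circle2Pi → ℂ) (a n : ℤ) (x : Circle2Pi) :
    tsupport (fun s : Circle2Pi => fourier a s * F (n • s + x)) ⊆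
      (fun s : Circle2Pi => n • s + x) ⁻¹' (tsupport F) := by
  apply closure_minimal
  · intro s hs
    apply subset_tsupport
    intro h
    apply hs
    simp [h]
  · exact (isClosed_tsupport F).preimage (by fun_prop)

lemma avg_ineq (φ : (Circle2Pi → ℂ) →ₗ[ℂ] (Circle2Pi → ℂ) →ₗ[ℂ] ℂ)
    (hφnorm : ∀ f g : Circle2Pi → ℂ, MemFourierAlg f → MemFourierAlg g →
      ‖φ f g‖ ≤ fourierAlgNorm f * fourierAlgNorm g)
    (α : ℝ) (hα0 : 0 ≤ α)
    (hdisj : ∀ f g : Circle2Pi → ℂ, MemFourierAlg f → MemFourierAlg g →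
      tsupport f ∩ tsupport g = ∅ →
      ‖φ f g‖ ≤ α * fourierAlgNorm f * fourierAlgNorm g) (n a b : ℤ)
    (F G : Circle2Pi → ℂ) (hF : MemFourierAlg F) (hG : MemFourierAlg G)
    (hFG : tsupport F ∩ tsupport G = ∅) :
    ‖∑' k : ℤ, (fourierCoeff F k * fourierCoeff G (1 - k)) *
      φ (fun s => fourier (a + n * k) s) (fun s => fourier (b + n * (1 - k)) s)‖
      ≤ α * fourierAlgNorm F * fourierAlgNorm G := by
  have hb : ∀ a b : ℤ, ‖φ (fun s => fourier a s) (fun s => fourier b s)‖ ≤ 1 := by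
    intro a b
    refine (hφnorm _ _ (memA_fourier a).1 (memA_fourier b).1).trans ?_
    exact mul_le_one₀ (memA_fourier a).2 (algNorm_nonneg _) (memA_fourier b).2
  set w : ℤ × ℤ → ℂ := fun p => (fourierCoeff F p.1 * fourierCoeff G p.2) *
    φ (fun s => fourier (a + n * p.1) s) (fun s => fourier (b + n * p.2) s) with hw
  have hws : Summable fun p => ‖w p‖ := by
    refine Summable.of_nonneg_of_le (fun _ => norm_nonneg _) ?_
      (hF.2.mul_of_nonneg hG.2 (fun _ => norm_nonneg _) (fun _ => norm_nonneg _))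
    intro p
    rw [hw, norm_mul, norm_mul]
    exact mul_le_of_le_one_right (by positivity) (hb _ _)
  have hn : ∀ (H : Circle2Pi → ℂ) (x : Circle2Pi) (i : ℤ), ‖fourierCoeff H i * fourier i x‖
      = ‖fourierCoeff H i‖ := by
    intro H x i; rw [norm_mul, norm_fourier_pt, mul_one]
  have hP : ∀ x : Circle2Pi, ‖∑' p : ℤ × ℤ, w p * fourier (p.1 + p.2) x‖
      ≤ α * fourierAlgNorm F * fourierAlgNorm G := by
    intro x
    have hFs : Summable fun i => ‖fourierCoeff F i * fourier i x‖ := by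
      simp_rw [hn]; exact hF.2
    have hGs : Summable fun i => ‖fourierCoeff G i * fourier i x‖ := by
      simp_rw [hn]; exact hG.2
    have h1 := series_hasSum2 φ hφnorm _ hFs (fun i => a + n * i) _ hGs (fun i => b + n * i)
    have h2 := mem_series _ hFs (fun i => a + n * i)
    have h3 := mem_series _ hGs (fun i => b + n * i)
    have e1 : ∀ p : ℤ × ℤ, w p * fourier (p.1 + p.2) x =
        fourierCoeff F p.1 * fourier p.1 x * (fourierCoeff G p.2 * fourier p.2 x) *
        φ (fun s => fourier (a + n * p.1) s) (fun s => fourier (b + n * p.2) s) := by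
      intro p
      rw [fourier_add]
      simp only [hw]
      ring
    simp_rw [e1]
    rw [h1.tsum_eq]
    refine (hdisj _ _ h2.1 h3.1 ?_).trans ?_
    · simp_rw [← affine_eq hF, ← affine_eq hG]
      apply Set.eq_empty_of_forall_notMem
      rintro s ⟨hs1, hs2⟩
      have t1 := affine_tsupport F a n x hs1
      have t2 := affine_tsupport G b n x hs2
      have : (n • s + x) ∈ tsupport F ∩ tsupport G := ⟨t1, t2⟩
      rw [hFG] at this
      exact this
    · have h2' := h2.2
      have h3' := h3.2
      simp_rw [hn] at h2' h3'
      apply mul_le_mul (mul_le_mul_of_nonneg_left h2' hα0) h3' (algNorm_nonneg _)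
      exact mul_nonneg hα0 (algNorm_nonneg _)
  have hc := coeff_series w hws (fun p => p.1 + p.2) 1
  have hbd : ‖fourierCoeff (fun s : Circle2Pi => ∑' p : ℤ × ℤ, w p * fourier (p.1 + p.2) s) 1‖
      ≤ α * fourierAlgNorm F * fourierAlgNorm G := by
    rw [fourierCoeff]
    have := norm_integral_le_of_norm_le_const (μ := (haarAddCircle : Measure Circle2Pi))
      (f := fun t => fourier (-1) t • ∑' p : ℤ × ℤ, w p * fourier (p.1 + p.2) t)
      (C := α * fourierAlgNorm F * fourierAlgNorm G)
      (Filter.Eventually.of_forall (fun t => by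
        rw [norm_smul, norm_fourier_pt, one_mul]; exact hP t))
    simpa [-fourier_apply] using this
  rw [hc] at hbd
  convert hbd using 2
  have hinj : Function.Injective (fun k : ℤ => ((k, 1 - k) : ℤ × ℤ)) := by
    intro x y h; simpa using congrArg Prod.fst h
  rw [← hinj.tsum_eq]
  · simp [hw, -fourier_apply]
  · intro p hp
    have : p.1 + p.2 = 1 := by
      by_contra h
      apply hp
      simp [h]
    exact ⟨p.1, by ext <;> simp; omega⟩

lemma assemble (φ : (Circle2Pi → ℂ) →ₗ[ℂ] (Circle2Pi → ℂ) →ₗ[ℂ] ℂ)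
    (hφnorm : ∀ f g : Circle2Pi → ℂ, MemFourierAlg f → MemFourierAlg g →
      ‖φ f g‖ ≤ fourierAlgNorm f * fourierAlgNorm g)
    (C : ℝ) (n : ℤ)
    (hC : ∀ a b : ℤ, ‖φ (fun s => fourier (a + n) s) (fun s => fourier b s) -
      φ (fun s => fourier a s) (fun s => fourier (b + n) s)‖ ≤ C)
    (f h : Circle2Pi → ℂ) (hf : MemFourierAlg f) (hh : MemFourierAlg h) :
      ‖φ (fun s => f s * fourier n s) h - φ f (fun s => fourier n s * h s)‖ ≤
        C * (fourierAlgNorm f * fourierAlgNorm h) := by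
  have e1 : (fun s => f s * fourier n s) =
      fun s : Circle2Pi => ∑' i : ℤ, fourierCoeff f i * fourier (i + n) s := by
    funext s
    rw [mem_expand hf, ← tsum_mul_right]
    congr 1; funext i; rw [fourier_add]; ring
  have e2 : (fun s => fourier n s * h s) =
      fun s : Circle2Pi => ∑' i : ℤ, fourierCoeff h i * fourier (i + n) s := by
    funext s
    rw [mem_expand hh, ← tsum_mul_left]
    congr 1; funext i; rw [fourier_add]; ring
  have h1 := series_hasSum2 φ hφnorm _ hf.2 (fun i => i + n) _ hh.2 (fun i => i)
  have h2 := series_hasSum2 φ hφnorm _ hf.2 (fun i => i) _ hh.2 (fun i => i + n)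
  rw [← e1, ← (funext (mem_expand hh) : h = _)] at h1
  rw [← e2, ← (funext (mem_expand hf) : f = _)] at h2
  have h3 := h1.sub h2
  have hs := (hf.2.mul_of_nonneg hh.2 (fun _ => norm_nonneg _) (fun _ => norm_nonneg _))
  have h4 : HasSum (fun p : ℤ × ℤ => C * (‖fourierCoeff f p.1‖ * ‖fourierCoeff h p.2‖))
      (C * (fourierAlgNorm f * fourierAlgNorm h)) := by
    apply HasSum.mul_left
    exact hf.2.hasSum.mul hh.2.hasSum hs
  rw [← h3.tsum_eq]
  apply tsum_of_norm_bounded h4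
  intro p
  rw [← mul_sub, norm_mul, norm_mul, mul_comm]
  exact mul_le_mul_of_nonneg_right (hC _ _) (by positivity)

def chi (r : ℝ) : Circle2Pi → ℂ := (Metric.closedBall (0 : Circle2Pi) r).indicator (fun _ => 1)

def mass (r : ℝ) : ℝ := (haarAddCircle : Measure Circle2Pi).real (Metric.closedBall 0 r)

lemma mass_eq (r : ℝ) (h0 : 0 ≤ r) : mass r = min 1 (r / Real.pi) := by
  have hpi := Real.pi_pos
  have h := AddCircle.volume_closedBall (2 * Real.pi) (x := 0) r
  rw [volume_eq_smul_haarAddCircle] at h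
  have h2 := congrArg ENNReal.toReal h
  rw [Measure.smul_apply, smul_eq_mul, ENNReal.toReal_mul,
    ENNReal.toReal_ofReal (by positivity), ENNReal.toReal_ofReal (by positivity)] at h2
  change 2 * Real.pi * mass r = _ at h2
  have : mass r = min (2 * Real.pi) (2 * r) / (2 * Real.pi) := by
    rw [← h2]; field_simp
  rw [this, ← min_div_div_right (by positivity), div_self (by positivity)]
  congr 1
  field_simp

lemma mass_nonneg (r : ℝ) : 0 ≤ mass r := measureReal_nonneg

lemma chi_meas (r : ℝ) : Measurable (chi r) :=
  measurable_const.indicator Metric.isClosed_closedBall.measurableSet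

lemma chi_norm (r : ℝ) (x : Circle2Pi) :
    ‖chi r x‖ = (Metric.closedBall (0 : Circle2Pi) r).indicator (fun _ => (1 : ℝ)) x := by
  by_cases h : x ∈ Metric.closedBall (0 : Circle2Pi) r <;> simp [chi, h]

lemma chi_norm_le (r : ℝ) (x : Circle2Pi) : ‖chi r x‖ ≤ 1 := by
  by_cases h : x ∈ Metric.closedBall (0 : Circle2Pi) r <;> simp [chi, h]

lemma chi_conj (r : ℝ) (x : Circle2Pi) : (starRingEnd ℂ) (chi r x) = chi r x := by
  by_cases h : x ∈ Metric.closedBall (0 : Circle2Pi) r <;> simp [chi, h]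

lemma chi_int (r : ℝ) : ∫ x, ‖chi r x‖ ∂haarAddCircle = mass r := by
  simp_rw [chi_norm]
  rw [integral_indicator_const _ Metric.isClosed_closedBall.measurableSet]
  simp [mass]

lemma chi_int' (r : ℝ) : ∫ x, chi r x ∂haarAddCircle = mass r := by
  unfold chi
  rw [integral_indicator_const _ Metric.isClosed_closedBall.measurableSet]
  simp [mass]

lemma chi_integrable (r : ℝ) : Integrable (chi r) haarAddCircle :=
  Integrable.of_bound (chi_meas r).aestronglyMeasurable 1 (.of_forall (chi_norm_le r))

lemma u_le (x : Circle2Pi) : ‖fourier 1 x - 1‖ ≤ ‖x‖ := by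
  induction x using QuotientAddGroup.induction_on with
  | H y =>
    have hpi := Real.pi_pos
    rw [AddCircle.norm_eq]
    set z := y - round ((2 * Real.pi)⁻¹ * y) * (2 * Real.pi) with hz
    have e : ((y : ℝ) : Circle2Pi) = (z : Circle2Pi) := by
      rw [hz, AddCircle.coe_sub]
      have : ((round ((2 * Real.pi)⁻¹ * y) * (2 * Real.pi) : ℝ) : Circle2Pi) = 0 := by
        rw [AddCircle.coe_eq_zero_iff]
        exact ⟨round ((2 * Real.pi)⁻¹ * y), by simp⟩
      rw [this, sub_zero]
    change ‖fourier 1 ((y : ℝ) : Circle2Pi) - 1‖ ≤ _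
    rw [e, fourier_coe_apply]
    have : (2 * Real.pi * Complex.I * (1 : ℤ) * z / ((2 * Real.pi : ℝ) : ℂ) : ℂ)
        = Complex.I * z := by
      have : (Real.pi : ℂ) ≠ 0 := by exact_mod_cast hpi.ne'
      push_cast
      field_simp
    rw [this]
    simpa using Real.norm_exp_I_mul_ofReal_sub_one_le (x := z)

def uchi (r : ℝ) : Circle2Pi → ℂ := fun x => (fourier 1 x - 1) * chi r x

lemma uchi_le (r : ℝ) (_h0 : 0 ≤ r) (x : Circle2Pi) : ‖uchi r x‖ ≤ r * ‖chi r x‖ := by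
  rw [uchi, norm_mul]
  by_cases h : x ∈ Metric.closedBall (0 : Circle2Pi) r
  · apply mul_le_mul_of_nonneg_right _ (norm_nonneg _)
    exact (u_le x).trans (by simpa using h)
  · simp [chi, h]

lemma uchi_meas (r : ℝ) : Measurable (uchi r) := by
  have : Measurable (fun x : Circle2Pi => fourier 1 x - 1) :=
    ((map_continuous (fourier 1)).sub continuous_const).measurable
  exact this.mul (chi_meas r)

lemma uchi_bdd (r : ℝ) (h0 : 0 ≤ r) (x : Circle2Pi) : ‖uchi r x‖ ≤ r :=
  (uchi_le r h0 x).trans (mul_le_of_le_one_right h0 (chi_norm_le r x))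

lemma coeff_bound (f : Circle2Pi → ℂ) (k : ℤ) :
    ‖fourierCoeff f k‖ ≤ ∫ x, ‖f x‖ ∂haarAddCircle := by
  rw [fourierCoeff]
  refine (norm_integral_le_integral_norm _).trans (le_of_eq ?_)
  congr 1; funext x
  rw [norm_smul, norm_fourier_pt, one_mul]

lemma parseval' (f : Circle2Pi → ℂ) (hf : MemLp f 2 haarAddCircle) :
    HasSum (fun k : ℤ => ‖fourierCoeff f k‖ ^ 2) (∫ x, ‖f x‖ ^ 2 ∂haarAddCircle) := by
  have h := hasSum_sq_fourierCoeff hf.toLp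
  rw [fourierCoeff_congr_ae hf.coeFn_toLp] at h
  convert h using 1
  apply integral_congr_ae
  filter_upwards [hf.coeFn_toLp] with x hx
  rw [hx]

lemma chi_memLp (r : ℝ) : MemLp (chi r) 2 haarAddCircle :=
  MemLp.of_bound (chi_meas r).aestronglyMeasurable 1 (.of_forall (chi_norm_le r))

lemma uchi_memLp (r : ℝ) (h0 : 0 ≤ r) : MemLp (uchi r) 2 haarAddCircle :=
  MemLp.of_bound (uchi_meas r).aestronglyMeasurable r (.of_forall (uchi_bdd r h0))

lemma uchi_integrable (r : ℝ) (h0 : 0 ≤ r) : Integrable (uchi r) haarAddCircle :=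
  Integrable.of_bound (uchi_meas r).aestronglyMeasurable r (.of_forall (uchi_bdd r h0))

def bb (r : ℝ) (k : ℤ) : ℂ := fourierCoeff (chi r) k

lemma bb_sq (r : ℝ) : HasSum (fun k => ‖bb r k‖ ^ 2) (mass r) := by
  have h := parseval' _ (chi_memLp r)
  have e : mass r = ∫ x, ‖chi r x‖ ^ 2 ∂haarAddCircle := by
    rw [← chi_int]
    congr 1; funext x
    by_cases h : x ∈ Metric.closedBall (0 : Circle2Pi) r <;> simp [chi, h]
  rw [e]
  exact h

lemma bb_le (r : ℝ) (k : ℤ) : ‖bb r k‖ ≤ mass r := by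
  rw [← chi_int]; exact coeff_bound _ _

lemma bb_zero (r : ℝ) : bb r 0 = mass r := by
  rw [bb, fourierCoeff, ← chi_int']
  simp

lemma coeff_mul_fourier (f : Circle2Pi → ℂ) (k : ℤ) :
    fourierCoeff (fun x => fourier 1 x * f x) k = fourierCoeff f (k - 1) := by
  rw [fourierCoeff, fourierCoeff]
  congr 1; funext x
  rw [smul_eq_mul, smul_eq_mul, ← mul_assoc, ← fourier_add]
  congr 3; ring

lemma bb_diff (r : ℝ) (k : ℤ) : bb r (k - 1) - bb r k = fourierCoeff (uchi r) k := by
  rw [bb, bb, ← coeff_mul_fourier, fourierCoeff, fourierCoeff, fourierCoeff, ← integral_sub]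
  · congr 1; funext x
    simp only [uchi, smul_eq_mul]; ring
  · apply Integrable.fourier_smul
    exact (chi_integrable r).fourier_smul 1
  · exact (chi_integrable r).fourier_smul _

lemma bb_diff_le (r : ℝ) (h0 : 0 ≤ r) (k : ℤ) : ‖bb r (k - 1) - bb r k‖ ≤ r * mass r := by
  rw [bb_diff, ← chi_int, ← integral_const_mul]
  refine (coeff_bound _ _).trans ?_
  exact integral_mono (uchi_integrable r h0).norm ((chi_integrable r).norm.const_mul r)
    (uchi_le r h0)

lemma bb_diff_sq (r : ℝ) (h0 : 0 ≤ r) : Summable (fun k => ‖bb r (k - 1) - bb r k‖ ^ 2) ∧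
    ∑' k, ‖bb r (k - 1) - bb r k‖ ^ 2 ≤ r ^ 2 * mass r := by
  simp_rw [bb_diff]
  have h := parseval' _ (uchi_memLp r h0)
  refine ⟨h.summable, ?_⟩
  rw [h.tsum_eq, ← chi_int, ← integral_const_mul]
  apply integral_mono
  · exact (uchi_memLp r h0).integrable_norm_pow (by norm_num)
  · exact (chi_integrable r).norm.const_mul _
  · intro x
    have h1 := uchi_le r h0 x
    have h2 := chi_norm_le r x
    simp only
    calc ‖uchi r x‖ ^ 2 ≤ (r * ‖chi r x‖) ^ 2 := by gcongr
      _ = r ^ 2 * (‖chi r x‖ * ‖chi r x‖) := by ring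
      _ ≤ r ^ 2 * (‖chi r x‖ * 1) := by gcongr
      _ = _ := by ring

lemma bb_conv (r p : ℝ) (x : Circle2Pi) :
    ∑' k, (bb r k * bb p k) * fourier k x = ∫ y, chi r y * chi p (x - y) ∂haarAddCircle := by
  have hX : MemLp (fun y => chi p (x - y)) 2 (haarAddCircle : Measure Circle2Pi) :=
    MemLp.of_bound ((chi_meas p).comp (measurable_const.sub measurable_id)).aestronglyMeasurable 1
      (.of_forall fun y => chi_norm_le p _)
  have hY := chi_memLp r
  have h := (fourierBasis (T := 2 * Real.pi)).tsum_inner_mul_inner hX.toLp hY.toLp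
  have e1 : ∀ k, inner ℂ (fourierBasis (T := 2 * Real.pi) k) hY.toLp = bb r k := by
    intro k
    rw [← HilbertBasis.repr_apply_apply, fourierBasis_repr, fourierCoeff_congr_ae hY.coeFn_toLp]
    rfl
  have e2 : ∀ k, inner ℂ hX.toLp (fourierBasis (T := 2 * Real.pi) k) = bb p k * fourier k x := by
    intro k
    rw [← inner_conj_symm, ← HilbertBasis.repr_apply_apply, fourierBasis_repr,
      fourierCoeff_congr_ae hX.coeFn_toLp, fourierCoeff, ← integral_conj]
    rw [← integral_sub_left_eq_self _ _ x, bb, fourierCoeff, ← integral_mul_const]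
    congr 1; funext y
    simp only [sub_sub_cancel, smul_eq_mul, map_mul, chi_conj]
    rw [← fourier_neg, neg_neg]
    have : fourier k (x - y) = fourier (-k) y * fourier k x := by
      have := fourier_affine k (-1) y x
      rw [show x - y = (-1 : ℤ) • y + x by simp [sub_eq_add_neg, add_comm], this, neg_one_mul]
    rw [this]; ring
  have e3 : inner ℂ hX.toLp hY.toLp = ∫ y, chi r y * chi p (x - y) ∂haarAddCircle := by
    rw [L2.inner_def]
    apply integral_congr_ae
    filter_upwards [hX.coeFn_toLp, hY.coeFn_toLp] with y h1 h2
    rw [h1, h2, RCLike.inner_apply, chi_conj]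
  rw [← e3, ← h]
  congr 1; funext k
  rw [e1, e2]; ring

def TT (r p : ℝ) (k : ℤ) : ℂ := bb r k * bb r k * bb r (-k) * bb p (-k)

set_option maxHeartbeats 2000000 in
lemma TT_sum (r p : ℝ) (hr : 0 < r) (hp : p = 4 * r) (hm : mass p ≤ 4 * mass r) :
    Summable (fun k => ‖TT r p k‖) ∧ Summable (fun k => ‖TT r p (k - 1) - TT r p k‖) ∧
    ∑' k, ‖TT r p (k - 1) - TT r p k‖ ≤ 14 * r * mass r ^ 3 := by
  set M := mass r with hM
  have hM0 : 0 ≤ M := mass_nonneg r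
  have hp0 : 0 ≤ p := by linarith
  have ha : HasSum (fun k => ‖bb r k‖ ^ 2) M := bb_sq r
  have hx : HasSum (fun k => ‖bb r (-k)‖ ^ 2) M := (Equiv.neg ℤ).hasSum_iff.2 ha
  have hx' : HasSum (fun k => ‖bb r (-(k - 1))‖ ^ 2) M :=
    (Equiv.subRight (1 : ℤ)).hasSum_iff.2 hx
  have hy : HasSum (fun k => ‖bb p (-k)‖ ^ 2) (mass p) := (Equiv.neg ℤ).hasSum_iff.2 (bb_sq p)
  have hy' : HasSum (fun k => ‖bb p (-(k - 1))‖ ^ 2) (mass p) :=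
    (Equiv.subRight (1 : ℤ)).hasSum_iff.2 hy
  obtain ⟨hz0, hzle⟩ := bb_diff_sq p hp0
  set Z := ∑' k, ‖bb p (k - 1) - bb p k‖ ^ 2 with hZ
  have hflip : ∀ (q : ℝ) (k : ℤ), ‖bb q (-(k - 1)) - bb q (-k)‖ =
      ‖bb q ((1 - k) - 1) - bb q (1 - k)‖ := by
    intro q k
    rw [norm_sub_rev]
    congr 3 <;> ring
  have hz : HasSum (fun k => ‖bb p (-(k - 1)) - bb p (-k)‖ ^ 2) Z := by
    simp_rw [hflip]
    exact (Equiv.subLeft (1 : ℤ)).hasSum_iff.2 hz0.hasSum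
  have hmaj : HasSum (fun k => r * M ^ 2 * (2 * (‖bb r (-(k - 1))‖ ^ 2 + ‖bb p (-(k - 1))‖ ^ 2 / 4)
      + (‖bb r k‖ ^ 2 + ‖bb p (-(k - 1))‖ ^ 2 / 4))
      + M ^ 2 * (4 * r * ‖bb r (-k)‖ ^ 2 + ‖bb p (-(k - 1)) - bb p (-k)‖ ^ 2 / (16 * r)))
      (r * M ^ 2 * (2 * (M + mass p / 4) + (M + mass p / 4))
        + M ^ 2 * (4 * r * M + Z / (16 * r))) := by
    apply HasSum.add
    · apply HasSum.mul_left
      apply HasSum.add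
      · apply HasSum.mul_left
        exact hx'.add (hy'.div_const 4)
      · exact ha.add (hy'.div_const 4)
    · apply HasSum.mul_left
      exact (hx.mul_left _).add (hz.div_const _)
  have hbd : ∀ k, ‖TT r p (k - 1) - TT r p k‖ ≤
      r * M ^ 2 * (2 * (‖bb r (-(k - 1))‖ ^ 2 + ‖bb p (-(k - 1))‖ ^ 2 / 4)
      + (‖bb r k‖ ^ 2 + ‖bb p (-(k - 1))‖ ^ 2 / 4))
      + M ^ 2 * (4 * r * ‖bb r (-k)‖ ^ 2 + ‖bb p (-(k - 1)) - bb p (-k)‖ ^ 2 / (16 * r)) := by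
    intro k
    have A : ‖bb r k‖ ≤ M := bb_le r k
    have A' : ‖bb r (k - 1)‖ ≤ M := bb_le r _
    have dA : ‖bb r (k - 1) - bb r k‖ ≤ r * M := bb_diff_le r hr.le k
    have dB : ‖bb r (-(k - 1)) - bb r (-k)‖ ≤ r * M := by
      rw [hflip]; exact bb_diff_le r hr.le _
    have e : TT r p (k - 1) - TT r p k =
      (bb r (k - 1) - bb r k) * bb r (k - 1) * (bb r (-(k - 1)) * bb p (-(k - 1)))
      + bb r k * (bb r (k - 1) - bb r k) * (bb r (-(k - 1)) * bb p (-(k - 1)))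
      + bb r k * (bb r (-(k - 1)) - bb r (-k)) * (bb r k * bb p (-(k - 1)))
      + bb r k * bb r k * (bb r (-k) * (bb p (-(k - 1)) - bb p (-k))) := by
      simp only [TT]; ring
    rw [e]
    have n1 : ‖bb r (-(k - 1))‖ * ‖bb p (-(k - 1))‖ ≤
        ‖bb r (-(k - 1))‖ ^ 2 + ‖bb p (-(k - 1))‖ ^ 2 / 4 := by
      nlinarith [sq_nonneg (‖bb r (-(k - 1))‖ - ‖bb p (-(k - 1))‖ / 2)]
    have n2 : ‖bb r k‖ * ‖bb p (-(k - 1))‖ ≤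
        ‖bb r k‖ ^ 2 + ‖bb p (-(k - 1))‖ ^ 2 / 4 := by
      nlinarith [sq_nonneg (‖bb r k‖ - ‖bb p (-(k - 1))‖ / 2)]
    have n3 : ‖bb r (-k)‖ * ‖bb p (-(k - 1)) - bb p (-k)‖ ≤
        4 * r * ‖bb r (-k)‖ ^ 2 + ‖bb p (-(k - 1)) - bb p (-k)‖ ^ 2 / (16 * r) := by
      set X := ‖bb r (-k)‖
      set Y := ‖bb p (-(k - 1)) - bb p (-k)‖
      have : 4 * r * X ^ 2 + Y ^ 2 / (16 * r) - X * Y = (8 * r * X - Y) ^ 2 / (16 * r) := by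
        field_simp; ring
      have h2 : 0 ≤ (8 * r * X - Y) ^ 2 / (16 * r) := by positivity
      linarith
    have t1 : ‖(bb r (k - 1) - bb r k) * bb r (k - 1) * (bb r (-(k - 1)) * bb p (-(k - 1)))‖
        ≤ (r * M) * M * (‖bb r (-(k - 1))‖ ^ 2 + ‖bb p (-(k - 1))‖ ^ 2 / 4) := by
      simp only [norm_mul]; gcongr
    have t2 : ‖bb r k * (bb r (k - 1) - bb r k) * (bb r (-(k - 1)) * bb p (-(k - 1)))‖
        ≤ M * (r * M) * (‖bb r (-(k - 1))‖ ^ 2 + ‖bb p (-(k - 1))‖ ^ 2 / 4) := by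
      simp only [norm_mul]; gcongr
    have t3 : ‖bb r k * (bb r (-(k - 1)) - bb r (-k)) * (bb r k * bb p (-(k - 1)))‖
        ≤ M * (r * M) * (‖bb r k‖ ^ 2 + ‖bb p (-(k - 1))‖ ^ 2 / 4) := by
      simp only [norm_mul]; gcongr
    have t4 : ‖bb r k * bb r k * (bb r (-k) * (bb p (-(k - 1)) - bb p (-k)))‖
        ≤ M * M * (4 * r * ‖bb r (-k)‖ ^ 2 + ‖bb p (-(k - 1)) - bb p (-k)‖ ^ 2 / (16 * r)) := by
      simp only [norm_mul]; gcongr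
    refine (norm_add₄_le).trans ?_
    refine (add_le_add (add_le_add (add_le_add t1 t2) t3) t4).trans (le_of_eq ?_)
    ring
  have hS := Summable.of_nonneg_of_le (fun _ => norm_nonneg _) hbd hmaj.summable
  refine ⟨?_, hS, ?_⟩
  · refine Summable.of_nonneg_of_le (fun _ => norm_nonneg _) (fun k => ?_)
      ((hx.summable.add (hy.summable.div_const 4)).mul_left (M * M))
    have A : ‖bb r k‖ ≤ M := bb_le r k
    have n1 : ‖bb r (-k)‖ * ‖bb p (-k)‖ ≤ ‖bb r (-k)‖ ^ 2 + ‖bb p (-k)‖ ^ 2 / 4 := by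
      nlinarith [sq_nonneg (‖bb r (-k)‖ - ‖bb p (-k)‖ / 2)]
    rw [TT, mul_assoc]
    simp only [norm_mul]; gcongr
  · refine (hS.tsum_le_tsum hbd hmaj.summable).trans ?_
    rw [hmaj.tsum_eq]
    have hZ' : Z / (16 * r) ≤ 4 * r * M := by
      rw [div_le_iff₀ (by positivity)]
      refine hzle.trans ?_
      rw [hp] at hm ⊢
      nlinarith [mul_le_mul_of_nonneg_left hm (sq_nonneg (4 * r))]
    calc _ ≤ r * M ^ 2 * (2 * (M + 4 * M / 4) + (M + 4 * M / 4)) + M ^ 2 * (4 * r * M + 4 * r * M) := by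
          gcongr
      _ = _ := by ring

lemma bg_sum (r p : ℝ) (hm : mass p ≤ 4 * mass r) :
    Summable (fun k => ‖bb r k * bb p k‖) ∧ ∑' k, ‖bb r k * bb p k‖ ≤ 2 * mass r := by
  have hmaj : HasSum (fun k => ‖bb r k‖ ^ 2 + ‖bb p k‖ ^ 2 / 4) (mass r + mass p / 4) :=
    (bb_sq r).add ((bb_sq p).div_const 4)
  have hbd : ∀ k, ‖bb r k * bb p k‖ ≤ ‖bb r k‖ ^ 2 + ‖bb p k‖ ^ 2 / 4 := by
    intro k
    rw [norm_mul]
    nlinarith [sq_nonneg (‖bb r k‖ - ‖bb p k‖ / 2)]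
  have hS := Summable.of_nonneg_of_le (fun _ => norm_nonneg _) hbd hmaj.summable
  refine ⟨hS, (hS.tsum_le_tsum hbd hmaj.summable).trans ?_⟩
  rw [hmaj.tsum_eq]; linarith

lemma bsq_sum (r : ℝ) : HasSum (fun k => ‖bb r k * bb r k‖) (mass r) := by
  simp_rw [norm_mul, ← sq]; exact bb_sq r

/-- A function with prescribed summable coefficients. -/
lemma exists_fun (c : ℤ → ℂ) (hc : Summable fun i => ‖c i‖) :
    MemFourierAlg (fun s : Circle2Pi => ∑' i, c i * fourier i s) ∧
    fourierAlgNorm (fun s : Circle2Pi => ∑' i, c i * fourier i s) = ∑' i, ‖c i‖ ∧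
    ∀ k, fourierCoeff (fun s : Circle2Pi => ∑' i, c i * fourier i s) k = c k := by
  have h := coeff_series c hc (fun i => i)
  have h' : ∀ k, fourierCoeff (fun s : Circle2Pi => ∑' i, c i * fourier i s) k = c k := by
    intro k; rw [h k, tsum_ite_eq]
  refine ⟨(mem_series c hc (fun i => i)).1, ?_, h'⟩
  simp_rw [fourierAlgNorm, h']

lemma shift_fun (f : Circle2Pi → ℂ) (hf : MemFourierAlg f) :
    MemFourierAlg (fun x => fourier 1 x * f x) ∧
    fourierAlgNorm (fun x => fourier 1 x * f x) = fourierAlgNorm f ∧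
    tsupport (fun x => fourier 1 x * f x) ⊆ tsupport f := by
  refine ⟨⟨(map_continuous (fourier 1)).mul hf.1, ?_⟩, ?_, ?_⟩
  · simp_rw [coeff_mul_fourier]
    exact (Equiv.subRight (1 : ℤ)).summable_iff.2 hf.2
  · simp_rw [fourierAlgNorm, coeff_mul_fourier]
    exact (Equiv.subRight (1 : ℤ)).tsum_eq (fun k => ‖fourierCoeff f k‖)
  · exact tsupport_mul_subset_right

lemma exists_test (r : ℝ) (hr : 0 < r) (hrpi : r ≤ Real.pi) :
    ∃ Om Ps : Circle2Pi → ℂ, MemFourierAlg Om ∧ MemFourierAlg Ps ∧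
      tsupport Om ∩ tsupport Ps = ∅ ∧
      fourierAlgNorm Om ≤ 1 / mass r ∧ fourierAlgNorm Ps ≤ 3 ∧
      (∀ k, fourierCoeff Om k = bb r k * bb r k / mass r ^ 2) ∧
      (∀ k, fourierCoeff Ps k = (if k = 0 then 1 else 0) - bb r k * bb (4 * r) k / mass r) := by
  have hpi := Real.pi_pos
  have hMr : mass r = r / Real.pi := by
    rw [mass_eq r hr.le, min_eq_right]
    rwa [div_le_one hpi]
  have hM0 : 0 < mass r := by rw [hMr]; positivity
  have hM0' : (mass r : ℂ) ≠ 0 := by exact_mod_cast hM0.ne'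
  have hm : mass (4 * r) ≤ 4 * mass r := by
    rw [mass_eq (4 * r) (by linarith), hMr]
    exact (min_le_right _ _).trans (le_of_eq (by ring))
  set c : ℤ → ℂ := fun k => bb r k * bb r k / mass r ^ 2 with hc
  set d : ℤ → ℂ := fun k => (if k = 0 then 1 else 0) - bb r k * bb (4 * r) k / mass r with hd
  have hcn : HasSum (fun k => ‖c k‖) (1 / mass r) := by
    have := (bsq_sum r).div_const (mass r ^ 2)
    have e1 : ∀ k, ‖c k‖ = ‖bb r k * bb r k‖ / mass r ^ 2 := by
      intro k
      simp only [hc, norm_div, norm_pow, Complex.norm_real, Real.norm_of_nonneg hM0.le]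
    have e2 : 1 / mass r = mass r / mass r ^ 2 := by field_simp
    simp_rw [e1, e2]
    exact this
  obtain ⟨hg1, hg2⟩ := bg_sum r (4 * r) hm
  have hd1 : HasSum (fun k : ℤ => if k = 0 then (1 : ℝ) else 0) 1 := hasSum_ite_eq 0 1
  have hd2 : HasSum (fun k => ‖bb r k * bb (4 * r) k / mass r‖)
      ((∑' k, ‖bb r k * bb (4 * r) k‖) / mass r) := by
    have := hg1.hasSum.div_const (mass r)
    simp_rw [norm_div, Complex.norm_real, Real.norm_of_nonneg hM0.le]
    exact this
  have hdb : ∀ k, ‖d k‖ ≤ (if k = 0 then (1 : ℝ) else 0) + ‖bb r k * bb (4 * r) k / mass r‖ := by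
    intro k
    refine (norm_sub_le _ _).trans (le_of_eq ?_)
    congr 1
    split_ifs <;> simp
  have hdn := Summable.of_nonneg_of_le (fun _ => norm_nonneg _) hdb (hd1.add hd2).summable
  have hdle : ∑' k, ‖d k‖ ≤ 3 := by
    refine (hdn.tsum_le_tsum hdb (hd1.add hd2).summable).trans ?_
    rw [(hd1.add hd2).tsum_eq]
    have : (∑' k, ‖bb r k * bb (4 * r) k‖) / mass r ≤ 2 := by
      rwa [div_le_iff₀ hM0]
    linarith
  obtain ⟨a1, a2, a3⟩ := exists_fun c hcn.summable
  obtain ⟨b1, b2, b3⟩ := exists_fun d hdn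
  have valO : ∀ s : Circle2Pi, ∑' k, c k * fourier k s =
      (∫ y, chi r y * chi r (s - y) ∂haarAddCircle) / mass r ^ 2 := by
    intro s
    rw [← bb_conv, ← tsum_div_const]
    congr 1; funext k; simp only [hc]; ring
  have valP : ∀ s : Circle2Pi, ∑' k, d k * fourier k s =
      1 - (∫ y, chi r y * chi (4 * r) (s - y) ∂haarAddCircle) / mass r := by
    intro s
    rw [← bb_conv, ← tsum_div_const]
    have h1 : HasSum (fun k : ℤ => (if k = 0 then (1 : ℂ) else 0)) 1 := hasSum_ite_eq 0 1
    have h2 : Summable (fun k => bb r k * bb (4 * r) k * fourier k s / mass r) := by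
      apply Summable.of_norm
      convert hd2.summable using 1
      funext k
      rw [norm_div, norm_div, norm_mul, norm_fourier_pt, mul_one]
    rw [← (h1.sub h2.hasSum).tsum_eq]
    congr 1; funext k
    simp only [hd]
    split_ifs with hk
    · simp only [hk, fourier_zero]; ring
    · ring
  refine ⟨_, _, a1, b1, ?_, a2.le.trans hcn.tsum_eq.le, b2.le.trans hdle, a3, b3⟩
  have sO : tsupport (fun s : Circle2Pi => ∑' k, c k * fourier k s) ⊆ Metric.closedBall 0 (2 * r) := by
    apply closure_minimal _ Metric.isClosed_closedBall
    intro s hs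
    by_contra hns
    apply hs
    simp only
    rw [valO s]
    have : ∀ y, chi r y * chi r (s - y) = 0 := by
      intro y
      by_cases h1 : y ∈ Metric.closedBall (0 : Circle2Pi) r
      · by_cases h2 : s - y ∈ Metric.closedBall (0 : Circle2Pi) r
        · exfalso; apply hns
          rw [mem_closedBall_zero_iff] at *
          calc ‖s‖ = ‖(s - y) + y‖ := by simp
            _ ≤ _ := norm_add_le _ _
            _ ≤ 2 * r := by linarith
        · simp [chi, h2]
      · simp [chi, h1]
    simp [this]
  have sP : tsupport (fun s : Circle2Pi => ∑' k, d k * fourier k s) ⊆ {s | 3 * r ≤ ‖s‖} := by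
    apply closure_minimal _ (isClosed_le continuous_const continuous_norm)
    intro s hs
    by_contra hns
    apply hs
    simp only
    rw [valP s]
    have : ∀ y, chi r y * chi (4 * r) (s - y) = chi r y := by
      intro y
      by_cases h1 : y ∈ Metric.closedBall (0 : Circle2Pi) r
      · have h2 : s - y ∈ Metric.closedBall (0 : Circle2Pi) (4 * r) := by
          rw [mem_closedBall_zero_iff] at *
          have hns' : ‖s‖ < 3 * r := by simpa using hns
          refine (norm_sub_le _ _).trans (by linarith)
        simp [chi, h2]
      · simp [chi, h1]
    simp_rw [this]
    rw [chi_int', div_self hM0', sub_self]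
  apply Set.eq_empty_of_forall_notMem
  rintro s ⟨h1, h2⟩
  have h1' := sO h1
  have h2' : 3 * r ≤ ‖s‖ := sP h2
  rw [mem_closedBall_zero_iff] at h1'
  linarith

lemma key_num (c : ℤ → ℂ) (hc : ∀ k, ‖c k‖ ≤ 1) (α : ℝ) (hα : 0 < α) (hα1 : α ≤ 1)
    (H : ∀ F G : Circle2Pi → ℂ, MemFourierAlg F → MemFourierAlg G →
      tsupport F ∩ tsupport G = ∅ →
      ‖∑' k : ℤ, (fourierCoeff F k * fourierCoeff G (1 - k)) * c k‖
      ≤ α * fourierAlgNorm F * fourierAlgNorm G) :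
    ‖c 1 - c 0‖ ≤ 12 * Real.sqrt (Real.pi * (1 + Real.sqrt 2)) * Real.sqrt α := by
  have hpi := Real.pi_pos
  have hpi3 := Real.pi_gt_three
  set r := Real.sqrt (6 * Real.pi * α / 14) with hrdef
  have hr : 0 < r := Real.sqrt_pos.2 (by positivity)
  have hr2 : r ^ 2 = 6 * Real.pi * α / 14 := Real.sq_sqrt (by positivity)
  have hrpi : r ≤ Real.pi := by
    apply Real.sqrt_le_iff.2 ⟨hpi.le, ?_⟩
    nlinarith
  have hMr : mass r = r / Real.pi := by
    rw [mass_eq r hr.le, min_eq_right]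
    rwa [div_le_one hpi]
  have hM0 : 0 < mass r := by rw [hMr]; positivity
  have hM0' : (mass r : ℂ) ≠ 0 := by exact_mod_cast hM0.ne'
  have hm : mass (4 * r) ≤ 4 * mass r := by
    rw [mass_eq (4 * r) (by linarith), hMr]
    exact (min_le_right _ _).trans (le_of_eq (by ring))
  obtain ⟨Om, Ps, hO, hP, hdis, hOn, hPn, hOc, hPc⟩ := exists_test r hr hrpi
  obtain ⟨hT1, hT2, hT3⟩ := TT_sum r (4 * r) hr rfl hm
  obtain ⟨o1, o2, o3⟩ := shift_fun Om hO
  obtain ⟨q1, q2, q3⟩ := shift_fun Ps hP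
  have hfar : α * fourierAlgNorm Om * fourierAlgNorm Ps ≤ 3 * Real.pi * α / r := by
    calc _ ≤ α * (1 / mass r) * 3 := by
          have := algNorm_nonneg Om
          have := algNorm_nonneg Ps
          gcongr
      _ = _ := by rw [hMr]; field_simp
  have H1 := H _ _ o1 hP (Set.subset_empty_iff.1 (hdis ▸ Set.inter_subset_inter_left _ o3))
  have H2 := H _ _ hO q1 (Set.subset_empty_iff.1 (hdis ▸ Set.inter_subset_inter_right _ q3))
  rw [o2] at H1
  rw [q2] at H2
  replace H1 := H1.trans hfar
  replace H2 := H2.trans hfar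
  simp_rw [coeff_mul_fourier, hOc, hPc] at H1 H2
  have sT : Summable (fun k => c k * (TT r (4 * r) k / mass r ^ 3)) := by
    apply Summable.of_norm_bounded (hT1.div_const (mass r ^ 3))
    intro k
    rw [norm_mul, norm_div, norm_pow, Complex.norm_real, Real.norm_of_nonneg hM0.le]
    exact mul_le_of_le_one_left (by positivity) (hc k)
  have sT' : Summable (fun k => c k * (TT r (4 * r) (k - 1) / mass r ^ 3)) := by
    apply Summable.of_norm_bounded
      (((Equiv.subRight (1 : ℤ)).summable_iff.2 hT1).div_const (mass r ^ 3))
    intro k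
    rw [norm_mul, norm_div, norm_pow, Complex.norm_real, Real.norm_of_nonneg hM0.le]
    exact mul_le_of_le_one_left (by positivity) (hc k)
  have hI1 : HasSum (fun k : ℤ => if k = 1 then c 1 else 0) (c 1) := hasSum_ite_eq 1 _
  have hI0 : HasSum (fun k : ℤ => if k = 0 then c 0 else 0) (c 0) := hasSum_ite_eq 0 _
  have E1 := (hI1.sub sT'.hasSum).tsum_eq
  have E0 := (hI0.sub sT.hasSum).tsum_eq
  have F1 : ∀ k : ℤ, bb r (k - 1) * bb r (k - 1) / mass r ^ 2 *
      ((if 1 - k = 0 then 1 else 0) - bb r (1 - k) * bb (4 * r) (1 - k) / mass r) * c k =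
      (if k = 1 then c 1 else 0) - c k * (TT r (4 * r) (k - 1) / mass r ^ 3) := by
    intro k
    rw [TT, show -(k - 1) = 1 - k by ring]
    by_cases hk : k = 1
    · subst hk
      simp only [sub_self, bb_zero, if_true]
      field_simp
    · rw [if_neg hk, if_neg (by omega)]
      field_simp
      ring
  have F0 : ∀ k : ℤ, bb r k * bb r k / mass r ^ 2 *
      ((if 1 - k - 1 = 0 then 1 else 0) - bb r (1 - k - 1) * bb (4 * r) (1 - k - 1) / mass r) * c k =
      (if k = 0 then c 0 else 0) - c k * (TT r (4 * r) k / mass r ^ 3) := by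
    intro k
    rw [TT, show 1 - k - 1 = -k by ring]
    by_cases hk : k = 0
    · subst hk
      simp only [neg_zero, bb_zero, if_true]
      field_simp
    · rw [if_neg hk, if_neg (by omega)]
      field_simp
      ring
  simp_rw [F1] at H1
  simp_rw [F0] at H2
  rw [E1] at H1
  rw [E0] at H2
  have hD := sT'.hasSum.sub sT.hasSum
  have hnear : ‖(∑' k, c k * (TT r (4 * r) (k - 1) / mass r ^ 3))
      - ∑' k, c k * (TT r (4 * r) k / mass r ^ 3)‖ ≤ 14 * r := by
    rw [← hD.tsum_eq]
    have hb := hT2.hasSum.div_const (mass r ^ 3)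
    refine (tsum_of_norm_bounded hb ?_).trans ?_
    · intro k
      rw [← mul_sub, ← sub_div, norm_mul, norm_div, norm_pow, Complex.norm_real,
        Real.norm_of_nonneg hM0.le]
      exact mul_le_of_le_one_left (by positivity) (hc k)
    · rwa [div_le_iff₀ (by positivity)]
  have htot : ‖c 1 - c 0‖ ≤ 6 * Real.pi * α / r + 14 * r := by
    have e : c 1 - c 0 = (c 1 - ∑' k, c k * (TT r (4 * r) (k - 1) / mass r ^ 3))
      - (c 0 - ∑' k, c k * (TT r (4 * r) k / mass r ^ 3))
      + ((∑' k, c k * (TT r (4 * r) (k - 1) / mass r ^ 3))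
      - ∑' k, c k * (TT r (4 * r) k / mass r ^ 3)) := by ring
    rw [e]
    refine (norm_add_le _ _).trans ?_
    refine (add_le_add ((norm_sub_le _ _).trans (add_le_add H1 H2)) hnear).trans (le_of_eq ?_)
    ring
  refine htot.trans ?_
  have e1 : 6 * Real.pi * α / r = 14 * r := by
    rw [div_eq_iff hr.ne']
    nlinarith
  rw [e1, mul_assoc, ← Real.sqrt_mul (by positivity)]
  have hs2 : (1.4 : ℝ) ≤ Real.sqrt 2 := Real.le_sqrt_of_sq_le (by norm_num)
  have hsq : (28 / 12 * r) ≤ Real.sqrt (Real.pi * (1 + Real.sqrt 2) * α) := by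
    apply Real.le_sqrt_of_sq_le
    rw [mul_pow, hr2]
    have hpa : 0 < Real.pi * α := by positivity
    nlinarith [mul_le_mul_of_nonneg_left hs2 hpa.le]
  linarith

lemma coef_bound (φ : (Circle2Pi → ℂ) →ₗ[ℂ] (Circle2Pi → ℂ) →ₗ[ℂ] ℂ)
    (hφnorm : ∀ f g : Circle2Pi → ℂ, MemFourierAlg f → MemFourierAlg g →
      ‖φ f g‖ ≤ fourierAlgNorm f * fourierAlgNorm g)
    (α : ℝ) (hα0 : 0 < α) (hα1 : α ≤ 1)
    (hdisj : ∀ f g : Circle2Pi → ℂ, MemFourierAlg f → MemFourierAlg g →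
      tsupport f ∩ tsupport g = ∅ →
      ‖φ f g‖ ≤ α * fourierAlgNorm f * fourierAlgNorm g) (n a b : ℤ) :
    ‖φ (fun s => fourier (a + n) s) (fun s => fourier b s) -
      φ (fun s => fourier a s) (fun s => fourier (b + n) s)‖ ≤
      12 * Real.sqrt (Real.pi * (1 + Real.sqrt 2)) * Real.sqrt α := by
  have h := key_num (fun k => φ (fun s => fourier (a + n * k) s)
    (fun s => fourier (b + n * (1 - k)) s)) (fun k => by
      refine (hφnorm _ _ (memA_fourier _).1 (memA_fourier _).1).trans ?_
      exact mul_le_one₀ (memA_fourier _).2 (algNorm_nonneg _) (memA_fourier _).2) α hα0 hα1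
    (fun F G hF hG hFG => avg_ineq φ hφnorm α hα0.le hdisj n a b F G hF hG hFG)
  simpa [-fourier_apply] using h

theorem stmt_1 (φ : (Circle2Pi → ℂ) →ₗ[ℂ] (Circle2Pi → ℂ) →ₗ[ℂ] ℂ)
    (hφnorm : ∀ f g : Circle2Pi → ℂ, MemFourierAlg f → MemFourierAlg g →
      ‖φ f g‖ ≤ fourierAlgNorm f * fourierAlgNorm g)
    (α : ℝ) (hα0 : 0 ≤ α) (hα1 : α ≤ 1)
    (hdisj : ∀ f g : Circle2Pi → ℂ, MemFourierAlg f → MemFourierAlg g →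
      tsupport f ∩ tsupport g = ∅ →
      ‖φ f g‖ ≤ α * fourierAlgNorm f * fourierAlgNorm g) :
    ∀ (n : ℤ) (f h : Circle2Pi → ℂ), MemFourierAlg f → MemFourierAlg h →
      ‖φ (fun s => f s * fourier n s) h - φ f (fun s => fourier n s * h s)‖ ≤
        12 * Real.sqrt (Real.pi * (1 + Real.sqrt 2)) * Real.sqrt α *
          (fourierAlgNorm f * fourierAlgNorm h) := by
  intro n f h hf hh
  refine assemble φ hφnorm _ n (fun a b => ?_) f h hf hh
  rcases hα0.eq_or_lt with h0 | h0
  · subst h0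
    have hlim : Filter.Tendsto
        (fun β : ℝ => 12 * Real.sqrt (Real.pi * (1 + Real.sqrt 2)) * Real.sqrt β)
        (nhdsWithin 0 (Set.Ioi 0))
        (nhds (12 * Real.sqrt (Real.pi * (1 + Real.sqrt 2)) * Real.sqrt 0)) :=
      ((Real.continuous_sqrt.tendsto 0).const_mul _).mono_left nhdsWithin_le_nhds
    refine ge_of_tendsto hlim ?_
    filter_upwards [Ioc_mem_nhdsGT (zero_lt_one : (0 : ℝ) < 1)] with β hβ
    refine coef_bound φ hφnorm β hβ.1 hβ.2 (fun f g hf hg hfg => (hdisj f g hf hg hfg).trans ?_) n a b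
    rw [zero_mul, zero_mul]
    exact mul_nonneg (mul_nonneg hβ.1.le (algNorm_nonneg _)) (algNorm_nonneg _)
  · exact coef_bound φ hφnorm α h0 hα1 hdisj n a b
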